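/- There exists a subgroup N of H²(H/Z, D) ⊕ H²(K/Z, D) with N ≅ Hom(Z, D) such that H²(G, D) embeds into ((H²(H/Z, D) ⊕ H²(K/Z, D))/N) ⊕ Hom(H ⊗ K, D). -/

import Mathlib

/-!
Setting (central products): `G` is a group with normal subgroups `H` and `K` such that
`G = HK` (i.e. `H ⊔ K = ⊤`) and `[H, K] = 1` (i.e. every element of `H` commutes with
every element of `K`).  We set `A = H ⊓ K` and `Z = ⁅H,H⁆ ⊓ ⁅K,K⁆`; both are central
in `G`.  Coefficients are taken in a divisible abelian group `D`, regarded as a trivial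
module.  Second cohomology `H2 X D` is realized concretely as (inhomogeneous)
2-cocycles modulo 2-coboundaries, and `Hom(X, D)` is realized as `Additive X →+ D`.
-/

open scoped TensorProduct

set_option maxHeartbeats 1000000
set_option synthInstance.maxHeartbeats 1000000
set_option synthInstance.maxSize 2000

namespace SchurCP

variable (G : Type) [Group G] (D : Type) [AddCommGroup D]

/-- The group of 2-cocycles on `G` with values in the trivial module `D`. -/
def cocycles2 : AddSubgroup (G → G → D) where
  carrier := {f | ∀ g h k : G, f g h + f (g * h) k = f h k + f g (h * k)}
  zero_mem' := by intro g h k; simp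
  add_mem' := by
    intro a b ha hb g h k
    simp only [Pi.add_apply]
    rw [add_add_add_comm, ha g h k, hb g h k, add_add_add_comm]
  neg_mem' := by
    intro a ha g h k
    simp only [Pi.neg_apply]
    rw [← neg_add, ← neg_add, ha g h k]

/-- The group of 2-coboundaries on `G` with values in the trivial module `D`. -/
def coboundaries2 : AddSubgroup (G → G → D) where
  carrier := {f | ∃ φ : G → D, ∀ g h : G, f g h = φ g + φ h - φ (g * h)}
  zero_mem' := ⟨0, by simp⟩
  add_mem' := by
    rintro a b ⟨φ, hφ⟩ ⟨ψ, hψ⟩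
    exact ⟨φ + ψ, fun g h => by simp only [Pi.add_apply, hφ g h, hψ g h]; abel⟩
  neg_mem' := by
    rintro a ⟨φ, hφ⟩
    exact ⟨-φ, fun g h => by simp only [Pi.neg_apply, hφ g h]; abel⟩

/-- The second cohomology group `H²(G, D)` of `G` with coefficients in the
trivial module `D`. -/
def H2 : Type := cocycles2 G D ⧸ (coboundaries2 G D).addSubgroupOf (cocycles2 G D)

instance : AddCommGroup (H2 G D) :=
  QuotientAddGroup.Quotient.addCommGroup ((coboundaries2 G D).addSubgroupOf (cocycles2 G D))

variable {G D}

/-- The cohomology class of a 2-cocycle. -/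
abbrev H2mk (f : cocycles2 G D) : H2 G D := QuotientAddGroup.mk f

/-- Pullback of a 2-cocycle along a group homomorphism. -/
def pullCocycle {G' : Type} [Group G'] (π : G' →* G) :
    cocycles2 G D →+ cocycles2 G' D where
  toFun f := ⟨fun x y => (f : G → G → D) (π x) (π y), by
    intro x y z
    simpa only [map_mul] using f.2 (π x) (π y) (π z)⟩
  map_zero' := rfl
  map_add' _ _ := rfl

/-- The homomorphism `H²(G, D) → H²(G', D)` induced by a group homomorphism
`π : G' → G`; this specializes to restriction maps (for inclusions of subgroups)
and to inflation maps (for quotient maps). -/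
def H2Map {G' : Type} [Group G'] (π : G' →* G) : H2 G D →+ H2 G' D :=
  QuotientAddGroup.map _ _ (pullCocycle π) (by
    intro f hf
    rw [AddSubgroup.mem_addSubgroupOf] at hf
    rw [AddSubgroup.mem_comap, AddSubgroup.mem_addSubgroupOf]
    obtain ⟨φ, hφ⟩ := hf
    exact ⟨fun x => φ (π x), fun x y => by
      show (f : G → G → D) (π x) (π y) = _
      rw [hφ (π x) (π y), ← map_mul]⟩)

theorem commutator_le_self {X : Type} [Group X] (H : Subgroup X) : ⁅H, H⁆ ≤ H := by
  rw [Subgroup.commutator_le]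
  intro g₁ h₁ g₂ h₂
  rw [commutatorElement_def]
  exact H.mul_mem (H.mul_mem (H.mul_mem h₁ h₂) (H.inv_mem h₁)) (H.inv_mem h₂)

theorem inf_commutator_le_inf {X : Type} [Group X] (H K : Subgroup X) :
    ⁅H, H⁆ ⊓ ⁅K, K⁆ ≤ H ⊓ K :=
  inf_le_inf (commutator_le_self H) (commutator_le_self K)

theorem subgroupOf_le {X : Type} [Group X] {B C : Subgroup X} (h : B ≤ C)
    (J : Subgroup X) : B.subgroupOf J ≤ C.subgroupOf J := fun _x hx => h hx

/-- The natural projection `X/N → X/M` for `N ≤ M`. -/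
def quotProj {X : Type} [Group X] {N M : Subgroup X} [N.Normal] [M.Normal] (h : N ≤ M) :
    (X ⧸ N) →* (X ⧸ M) :=
  QuotientGroup.map N M (MonoidHom.id X) (by rwa [Subgroup.comap_id])

/-- The inflation homomorphism `H²(X/M, D) → H²(X/N, D)` for `N ≤ M`. -/
def inflMap {X : Type} [Group X] {N M : Subgroup X} [N.Normal] [M.Normal]
    (h : N ≤ M) (D : Type) [AddCommGroup D] : H2 (X ⧸ M) D →+ H2 (X ⧸ N) D :=
  H2Map (quotProj h)

/-- The natural homomorphism `H/(A ∩ H) → X/A` for subgroups `A, H` of `X`;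
for `A ≤ H` this realizes `H/A` as a subgroup of `X/A`. -/
def quotInclusion {X : Type} [Group X] (H A : Subgroup X) [A.Normal]
    [(A.subgroupOf H).Normal] : (↥H ⧸ A.subgroupOf H) →* X ⧸ A :=
  QuotientGroup.map (A.subgroupOf H) A H.subtype (fun _x hx => hx)

/-- The abelian tensor product `X ⊗ Y = X/[X,X] ⊗_ℤ Y/[Y,Y]` of two groups. -/
abbrev AbTensor (X Y : Type) [Group X] [Group Y] : Type :=
  TensorProduct ℤ (Additive (Abelianization X)) (Additive (Abelianization Y))

/-- The element `x[X,X] ⊗ y[Y,Y]` of the abelian tensor product. -/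
noncomputable abbrev tmulAb {X Y : Type} [Group X] [Group Y] (x : X) (y : Y) :
    AbTensor X Y :=
  Additive.ofMul (Abelianization.of x) ⊗ₜ[ℤ] Additive.ofMul (Abelianization.of y)

/-- The map on abelian tensor products induced by a pair of group homomorphisms. -/
noncomputable def abTensorMap {X Y X' Y' : Type} [Group X] [Group Y] [Group X'] [Group Y']
    (f : X →* X') (g : Y →* Y') : AbTensor X Y →ₗ[ℤ] AbTensor X' Y' :=
  TensorProduct.map (MonoidHom.toAdditive (Abelianization.map f)).toIntLinearMap
    (MonoidHom.toAdditive (Abelianization.map g)).toIntLinearMap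

theorem H2mk_eq_zero_iff {G D : Type} [Group G] [AddCommGroup D] (f : cocycles2 G D) :
    H2mk f = 0 ↔ ∃ φ : G → D, ∀ g h : G, f.1 g h = φ g + φ h - φ (g * h) :=
  QuotientAddGroup.eq_zero_iff f

theorem H2mk_surjective {G D : Type} [Group G] [AddCommGroup D] (x : H2 G D) :
    ∃ f : cocycles2 G D, H2mk f = x :=
  QuotientAddGroup.mk_surjective x

section Cocycle

variable {G D : Type} [Group G] [AddCommGroup D] (f : cocycles2 G D)

theorem cocycle_apply_one_right (g : G) : f.1 g 1 = f.1 1 1 := by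
  have := f.2 g 1 1
  simp only [mul_one] at this
  exact add_right_cancel this

theorem cocycle_apply_one_left (g : G) : f.1 1 g = f.1 1 1 := by
  have := f.2 1 1 g
  simp only [one_mul] at this
  exact (add_right_cancel this).symm

/-- For a fixed second argument, the commutator pairing of a cocycle is additive in the first
argument among elements commuting with the second. -/
theorem commPairing_mul_left {h h' k : G} (hk : Commute h k) (hk' : Commute h' k) :
    f.1 (h * h') k - f.1 k (h * h') = (f.1 h k - f.1 k h) + (f.1 h' k - f.1 k h') := by
  have h1 := f.2 h h' k
  have h2 := f.2 k h h'
  have h3 := f.2 h k h'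
  rw [hk'.eq] at h1
  rw [← hk.eq] at h2
  linear_combination (norm := abel) h1 + h2 - h3

theorem commPairing_mul_right {h k k' : G} (hk : Commute h k) (hk' : Commute h k') :
    f.1 h (k * k') - f.1 (k * k') h = (f.1 h k - f.1 k h) + (f.1 h k' - f.1 k' h) := by
  have := commPairing_mul_left f hk.symm hk'.symm
  linear_combination (norm := abel) -this

theorem cocycle_mul_mul {x y x' y' : G} (hyx : Commute y x') (hf : f.1 y x' = f.1 x' y) :
    f.1 (x * y) (x' * y') = f.1 x x' + f.1 y y' + f.1 (x * x') (y * y')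
      - f.1 x y - f.1 x' y' := by
  have h1 := f.2 (x * y) x' y'
  have h2 := f.2 x y x'
  have h3 := f.2 x x' y
  have h4 := f.2 (x * x') y y'
  rw [mul_assoc x y x', hyx.eq] at h1
  rw [hyx.eq] at h2
  rw [mul_assoc x x' y] at h4
  linear_combination (norm := abel) -h1 + h2 - h3 + h4 + hf

/-- If `k` commutes with all of `H`, the commutator pairing with `k` is a homomorphism on `H`. -/
def commPairingHom (H : Subgroup G) (k : G) (hk : ∀ h ∈ H, Commute h k) :
    H →* Multiplicative D where
  toFun h := .ofAdd (f.1 h k - f.1 k h)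
  map_one' := by simp [cocycle_apply_one_left, cocycle_apply_one_right]
  map_mul' h h' := by
    rw [← ofAdd_add, Subgroup.coe_mul, commPairing_mul_left f (hk h h.2) (hk h' h'.2)]

theorem cocycle_comm_of_mem_commutator {H : Subgroup G} {k z : G}
    (hk : ∀ h ∈ H, Commute h k) (hz : z ∈ ⁅H, H⁆) : f.1 z k = f.1 k z := by
  rw [← Subgroup.map_subtype_commutator] at hz
  obtain ⟨z, hz, rfl⟩ := hz
  exact sub_eq_zero.mp (Abelianization.commutator_subset_ker (commPairingHom f H k hk) hz)

end Cocycle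

/-- A homomorphism into a divisible group extends along any group homomorphism which is
injective modulo commutators. -/
theorem exists_extension_of_divisible {P W D : Type} [Group P] [Group W] [AddCommGroup D]
    [DivisibleBy D ℤ] (i : P →* W) (hi : ∀ p, i p ∈ commutator W → p = 1)
    (χ : P →* Multiplicative D) : ∃ θ : W →* Multiplicative D, ∀ p, θ (i p) = χ p := by
  have hinj : Function.Injective (MonoidHom.toAdditive (Abelianization.map i)) := by
    rw [injective_iff_map_eq_zero]
    intro a ha
    obtain ⟨p, hp⟩ : ∃ p, Abelianization.of p = Additive.toMul a :=
      QuotientGroup.mk'_surjective _ _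
    obtain rfl : a = Additive.ofMul (Abelianization.of p) := by rw [hp]; rfl
    have h1 : Abelianization.of (i p) = 1 := ha
    rw [← MonoidHom.mem_ker, Abelianization.ker_of] at h1
    rw [hi p h1, map_one]; rfl
  obtain ⟨h, hh⟩ := (Module.Baer.of_divisible D).extension_property_addMonoidHom _ hinj
    (MonoidHom.toAdditiveLeft (Abelianization.lift χ))
  refine ⟨(AddMonoidHom.toMultiplicativeRight h).comp Abelianization.of, fun p => ?_⟩
  exact congrArg Multiplicative.ofAdd
    (DFunLike.congr_fun hh (Additive.ofMul (Abelianization.of p)))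

/-- The central extension of `G` by `D` determined by a cocycle. -/
@[ext]
structure CocycleExt {G D : Type} [Group G] [AddCommGroup D] (f : cocycles2 G D) where
  /-- The component in `G`. -/
  fst : G
  /-- The component in `D`. -/
  snd : D

namespace CocycleExt

variable {G D : Type} [Group G] [AddCommGroup D] (f : cocycles2 G D)

instance : Mul (CocycleExt f) := ⟨fun a b => ⟨a.fst * b.fst, a.snd + b.snd + f.1 a.fst b.fst⟩⟩
instance : One (CocycleExt f) := ⟨⟨1, -f.1 1 1⟩⟩
instance : Inv (CocycleExt f) :=
  ⟨fun a => ⟨a.fst⁻¹, -a.snd - f.1 a.fst⁻¹ a.fst - f.1 1 1⟩⟩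

theorem mul_def (a b : CocycleExt f) :
    a * b = ⟨a.fst * b.fst, a.snd + b.snd + f.1 a.fst b.fst⟩ := rfl
theorem one_def : (1 : CocycleExt f) = ⟨1, -f.1 1 1⟩ := rfl
theorem inv_def (a : CocycleExt f) :
    a⁻¹ = ⟨a.fst⁻¹, -a.snd - f.1 a.fst⁻¹ a.fst - f.1 1 1⟩ := rfl

instance : Group (CocycleExt f) :=
  Group.ofLeftAxioms
    (fun a b c => by
      ext
      · simp only [mul_def, mul_assoc]
      · simp only [mul_def]
        linear_combination (norm := abel) f.2 a.fst b.fst c.fst)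
    (fun a => by
      ext
      · simp only [mul_def, one_def, one_mul]
      · simp only [mul_def, one_def, cocycle_apply_one_left]
        abel)
    (fun a => by
      ext
      · simp only [mul_def, one_def, inv_def, inv_mul_cancel]
      · simp only [mul_def, one_def, inv_def]
        abel)

/-- The inclusion of the coefficient group into the extension. -/
def inclusion : Multiplicative D →* CocycleExt f where
  toFun d := ⟨1, d.toAdd - f.1 1 1⟩
  map_one' := by ext <;> simp [one_def]
  map_mul' a b := by
    ext
    · simp [mul_def]
    · simp only [mul_def, toAdd_mul]
      abel

end CocycleExt

/-- A symmetric cocycle with divisible coefficients is a coboundary. -/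
theorem exists_coboundary_of_symm {Z D : Type} [Group Z] [AddCommGroup D] [DivisibleBy D ℤ]
    (f : cocycles2 Z D) (hZ : ∀ z w : Z, Commute z w) (hf : ∀ z w, f.1 z w = f.1 w z) :
    ∃ φ : Z → D, ∀ z w, f.1 z w = φ z + φ w - φ (z * w) := by
  have hcomm : ∀ a b : CocycleExt f, a * b = b * a := fun a b => by
    rw [CocycleExt.mul_def, CocycleExt.mul_def, (hZ a.fst b.fst).eq, hf a.fst, add_comm a.snd]
  have hbot : commutator (CocycleExt f) = ⊥ := by
    rw [commutator_def, Subgroup.commutator_eq_bot_iff_le_centralizer]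
    exact fun a _ b _ => hcomm b a
  obtain ⟨r, hr⟩ := exists_extension_of_divisible (CocycleExt.inclusion f) (fun d hd => by
    rw [hbot, Subgroup.mem_bot] at hd
    have := congrArg CocycleExt.snd hd
    simp only [CocycleExt.inclusion, CocycleExt.one_def, MonoidHom.coe_mk, OneHom.coe_mk] at this
    have h0 : d.toAdd = 0 := by linear_combination (norm := abel) this
    exact h0) (MonoidHom.id (Multiplicative D))
  refine ⟨fun z => (r ⟨z, 0⟩).toAdd, fun z w => ?_⟩
  have key : (⟨z, 0⟩ * ⟨w, 0⟩ : CocycleExt f)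
      = ⟨z * w, 0⟩ * CocycleExt.inclusion f (.ofAdd (f.1 z w)) := by
    ext
    · simp [CocycleExt.mul_def, CocycleExt.inclusion]
    · simp [CocycleExt.mul_def, CocycleExt.inclusion, cocycle_apply_one_right f (z * w)]
  have := congrArg (fun x => (r x).toAdd) key
  simp only [map_mul, hr, toAdd_mul, MonoidHom.id_apply, toAdd_ofAdd] at this
  rw [this]; abel

/-- If the kernel of a surjection `p` meets the commutator subgroup trivially, then inflation
along `p` is injective on second cohomology with divisible coefficients. -/
theorem H2Map_injective_of_ker_inf_commutator {W Q D : Type} [Group W] [Group Q]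
    [AddCommGroup D] [DivisibleBy D ℤ] (p : W →* Q) (hp : Function.Surjective p)
    (hker : ∀ w, p w = 1 → w ∈ commutator W → w = 1) :
    Function.Injective (H2Map p : H2 Q D →+ H2 W D) := by
  rw [injective_iff_map_eq_zero]
  intro x hx
  obtain ⟨f, rfl⟩ := H2mk_surjective x
  obtain ⟨φ, hφ⟩ := (H2mk_eq_zero_iff (pullCocycle p f)).mp hx
  replace hφ : ∀ g h, f.1 (p g) (p h) = φ g + φ h - φ (g * h) := hφ
  have hφmul : ∀ n w, p n = 1 → φ (n * w) = φ n + φ w - f.1 1 1 := fun n w hn => by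
    have := hφ n w
    rw [hn, cocycle_apply_one_left] at this
    rw [this]; abel
  let χ : p.ker →* Multiplicative D :=
    { toFun n := .ofAdd (f.1 1 1 - φ n)
      map_one' := by
        have := hφ 1 1
        simp only [map_one, mul_one, add_sub_cancel_right] at this
        simp [this]
      map_mul' n m := by
        rw [← ofAdd_add, Subgroup.coe_mul, hφmul n m n.2]
        congr 1; abel }
  obtain ⟨θ, hθ⟩ := exists_extension_of_divisible p.ker.subtype
    (fun n hn => Subtype.ext (hker n n.2 hn)) χ
  let ψ : W → D := fun w => φ w + (θ w).toAdd
  have hψ : ∀ w w', p w = p w' → ψ w = ψ w' := fun w w' h => by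
    have hn : p (w' * w⁻¹) = 1 := by simp [h]
    have h1 : (θ (w' * w⁻¹)).toAdd = f.1 1 1 - φ (w' * w⁻¹) :=
      congrArg Multiplicative.toAdd (hθ ⟨w' * w⁻¹, hn⟩)
    have h2 := hφmul _ w hn
    have h3 : (θ w').toAdd = (θ (w' * w⁻¹)).toAdd + (θ w).toAdd := by
      rw [← toAdd_mul, ← map_mul, inv_mul_cancel_right]
    rw [inv_mul_cancel_right] at h2
    simp only [ψ]
    linear_combination (norm := abel) -h1 - h2 - h3
  obtain ⟨s, hs⟩ := hp.hasRightInverse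
  refine (H2mk_eq_zero_iff f).mpr ⟨fun q => ψ (s q), fun q q' => ?_⟩
  have h1 : ψ (s (q * q')) = ψ (s q * s q') := hψ _ _ (by simp [hs _])
  have h2 := hφ (s q) (s q')
  rw [hs, hs] at h2
  simp only [h1]
  simp only [ψ, map_mul, toAdd_mul, h2]
  abel

section Inflation

variable {G Q D : Type} [Group G] [Group Q] [AddCommGroup D] {π : G →* Q}

/-- If the kernel of a surjection is central and pairs trivially with the group under the
commutator pairing of every cocycle, then inflation is surjective. -/
theorem H2Map_surjective_of_commPairing [DivisibleBy D ℤ] (hπ : Function.Surjective π)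
    (hcent : ∀ z g, π z = 1 → Commute z g)
    (hpair : ∀ (f : cocycles2 G D) (z g : G), π z = 1 → f.1 z g = f.1 g z) :
    Function.Surjective (H2Map π : H2 Q D →+ H2 G D) := by
  intro x
  obtain ⟨f, rfl⟩ := H2mk_surjective x
  obtain ⟨φ, hφ⟩ := exists_coboundary_of_symm (pullCocycle π.ker.subtype f)
    (fun z w => Subtype.ext (hcent z w z.2).eq) (fun z w => hpair f z w z.2)
  replace hφ : ∀ z w : π.ker, f.1 z w = φ z + φ w - φ (z * w) := hφ
  obtain ⟨s, hs⟩ := hπ.hasRightInverse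
  have hker : ∀ g, (s (π g))⁻¹ * g ∈ π.ker := fun g => by simp [MonoidHom.mem_ker, hs _]
  let ψ : G → D := fun g => φ ⟨(s (π g))⁻¹ * g, hker g⟩ - f.1 (s (π g)) ((s (π g))⁻¹ * g)
  have hψ : ∀ g z, (hz : π z = 1) → f.1 g z = ψ g + φ ⟨z, hz⟩ - ψ (g * z) := fun g z hz => by
    have hgz : π (g * z) = π g := by rw [map_mul, hz, mul_one]
    have h1 := f.2 (s (π g)) ((s (π g))⁻¹ * g) z
    have h2 := hφ ⟨_, hker g⟩ ⟨z, hz⟩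
    have h3 : ψ (g * z) = φ (⟨_, hker g⟩ * ⟨z, hz⟩)
        - f.1 (s (π g)) ((s (π g))⁻¹ * g * z) := by
      have : (⟨_, hker (g * z)⟩ : π.ker) = ⟨_, hker g⟩ * ⟨z, hz⟩ :=
        Subtype.ext (by simp only [hgz, Subgroup.coe_mul, mul_assoc])
      simp only [ψ, this]
      simp only [hgz, mul_assoc]
    rw [mul_inv_cancel_left] at h1
    simp only [h3]
    simp only [ψ]
    simp only at h2
    linear_combination (norm := abel) h1 + h2
  let η : G → D := fun g => ψ g + (f.1 1 1 - ψ 1)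
  let F : cocycles2 G D := ⟨fun g h => f.1 g h - (η g + η h - η (g * h)), fun g h k => by
    have := f.2 g h k
    simp only [mul_assoc]
    linear_combination (norm := abel) this⟩
  have hF : ∀ g h, F.1 g h = f.1 g h - (η g + η h - η (g * h)) := fun _ _ => rfl
  have hFr : ∀ g z, π z = 1 → F.1 g z = 0 := fun g z hz => by
    have h1 := hψ 1 z hz
    rw [cocycle_apply_one_left, one_mul] at h1
    rw [hF, hψ g z hz]
    simp only [η]
    linear_combination (norm := abel) -h1
  have hFl : ∀ z g, π z = 1 → F.1 z g = 0 := fun z g hz => by rw [hpair F z g hz, hFr g z hz]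
  have hFmulr : ∀ g h z, π z = 1 → F.1 g (h * z) = F.1 g h := fun g h z hz => by
    have := F.2 g h z
    rw [hFr _ z hz, hFr _ z hz, add_zero, zero_add] at this
    exact this.symm
  have hFmull : ∀ g h z, π z = 1 → F.1 (g * z) h = F.1 g h := fun g h z hz => by
    have := F.2 g z h
    rw [hFr _ z hz, hFl z _ hz, zero_add, zero_add, (hcent z h hz).eq, hFmulr _ _ _ hz] at this
    exact this
  have hFcongr : ∀ g g' h h', π g = π g' → π h = π h' → F.1 g h = F.1 g' h' :=
    fun g g' h h' hg hh => by
      rw [← hFmull g h (g⁻¹ * g') (by simp [hg]), ← hFmulr _ h (h⁻¹ * h') (by simp [hh]),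
        mul_inv_cancel_left, mul_inv_cancel_left]
  let F' : cocycles2 Q D := ⟨fun q r => F.1 (s q) (s r), fun q r t => by
    beta_reduce
    rw [hFcongr (s (q * r)) (s q * s r) (s t) (s t) (by simp [hs _]) rfl,
      hFcongr (s q) (s q) (s (r * t)) (s r * s t) rfl (by simp [hs _])]
    exact F.2 _ _ _⟩
  refine ⟨H2mk F', ?_⟩
  rw [← sub_eq_zero]
  refine (H2mk_eq_zero_iff (pullCocycle π F' - f)).mpr ⟨-η, fun g h => ?_⟩
  change F.1 (s (π g)) (s (π h)) - f.1 g h = _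
  rw [hFcongr _ g _ h (hs _) (hs _), hF]
  simp only [Pi.neg_apply]
  abel

/-- The factor set of a set-theoretic section of a surjection. -/
def factorSet {s : Q → G} (hs : Function.RightInverse s π) (q r : Q) : π.ker :=
  ⟨s q * s r * (s (q * r))⁻¹, by simp [MonoidHom.mem_ker, hs _]⟩

theorem factorSet_mul {s : Q → G} (hs : Function.RightInverse s π) (q r : Q) :
    (factorSet hs q r : G) * s (q * r) = s q * s r := by
  simp [factorSet]

theorem factorSet_cocycle (hcent : ∀ z g, π z = 1 → Commute z g) {s : Q → G}
    (hs : Function.RightInverse s π) (q r t : Q) :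
    factorSet hs q r * factorSet hs (q * r) t = factorSet hs r t * factorSet hs q (r * t) := by
  refine Subtype.ext (mul_right_cancel (b := s (q * r * t)) ?_)
  simp only [Subgroup.coe_mul]
  rw [mul_assoc, factorSet_mul, ← mul_assoc, factorSet_mul, mul_assoc q r t, mul_assoc,
    mul_assoc (factorSet hs r t : G), factorSet_mul, ← factorSet_mul hs r t, ← mul_assoc, ← mul_assoc,
    (hcent _ (s q) (factorSet hs r t).2).eq]

/-- The component in `ker π` of an element of `G`, relative to a section. -/
def kerPart {s : Q → G} (hs : Function.RightInverse s π) (g : G) : π.ker :=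
  ⟨g * (s (π g))⁻¹, by simp [MonoidHom.mem_ker, hs _]⟩

theorem kerPart_mul_section {s : Q → G} (hs : Function.RightInverse s π) (g : G) :
    (kerPart hs g : G) * s (π g) = g := by
  simp [kerPart]

theorem kerPart_mul (hcent : ∀ z g, π z = 1 → Commute z g) {s : Q → G}
    (hs : Function.RightInverse s π) (g h : G) :
    kerPart hs (g * h) = kerPart hs g * kerPart hs h * factorSet hs (π g) (π h) := by
  refine Subtype.ext (mul_right_cancel (b := s (π (g * h))) ?_)
  simp only [Subgroup.coe_mul]
  rw [kerPart_mul_section, map_mul, mul_assoc, factorSet_mul, mul_assoc,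
    ← mul_assoc (kerPart hs h : G), (hcent _ (s (π g)) (kerPart hs h).2).eq, mul_assoc,
    kerPart_mul_section, ← mul_assoc, kerPart_mul_section]

theorem kerPart_coe {s : Q → G} (hs : Function.RightInverse s π) (z : π.ker) :
    kerPart hs z = z * kerPart hs 1 := by
  refine Subtype.ext ?_
  simp [kerPart, MonoidHom.mem_ker.mp z.2]

/-- The transgression homomorphism `Hom(ker π, D) → H²(Q, D)` of a central extension. -/
def transgression (D : Type) [AddCommGroup D] (hcent : ∀ z g, π z = 1 → Commute z g) {s : Q → G}
    (hs : Function.RightInverse s π) : (Additive π.ker →+ D) →+ H2 Q D where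
  toFun χ := H2mk ⟨fun q r => χ (.ofMul (factorSet hs q r)), fun q r t => by
    beta_reduce
    rw [← map_add χ, ← map_add χ, ← ofMul_mul, ← ofMul_mul, factorSet_cocycle hcent]⟩
  map_zero' := rfl
  map_add' _ _ := rfl

theorem transgression_injective (hcent : ∀ z g, π z = 1 → Commute z g) {s : Q → G}
    (hs : Function.RightInverse s π) (hcomm : π.ker ≤ commutator G) :
    Function.Injective (transgression D hcent hs) := by
  rw [injective_iff_map_eq_zero]
  intro χ hχ
  obtain ⟨ψ, hψ⟩ := (H2mk_eq_zero_iff _).mp hχ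
  replace hψ : ∀ q r, χ (.ofMul (factorSet hs q r)) = ψ q + ψ r - ψ (q * r) := hψ
  let θ : G →* Multiplicative D := MonoidHom.mk'
    (fun g => .ofAdd (χ (.ofMul (kerPart hs g)) + ψ (π g))) (fun g h => by
      rw [← ofAdd_add, kerPart_mul hcent, ofMul_mul, ofMul_mul, map_add χ, map_add χ, hψ, map_mul]
      congr 1; abel)
  have hθ : ∀ z : π.ker, χ (.ofMul (kerPart hs z)) + ψ 1 = 0 := fun z => by
    have : θ z = 1 := Abelianization.commutator_subset_ker θ (hcomm z.2)
    have h1 : χ (.ofMul (kerPart hs z)) + ψ (π z) = 0 := this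
    rwa [z.2] at h1
  refine AddMonoidHom.ext fun z => ?_
  have h1 := hθ z.toMul
  have h2 := hθ 1
  rw [kerPart_coe, ofMul_mul, map_add χ] at h1
  rw [Subgroup.coe_one] at h2
  have h3 : χ (.ofMul z.toMul) = 0 := by linear_combination (norm := abel) h1 - h2
  exact h3

theorem range_transgression (hcent : ∀ z g, π z = 1 → Commute z g) {s : Q → G}
    (hs : Function.RightInverse s π) :
    (transgression D hcent hs).range = (H2Map π : H2 Q D →+ H2 G D).ker := by
  ext x
  constructor
  · rintro ⟨χ, rfl⟩
    refine (H2mk_eq_zero_iff (pullCocycle π _)).mpr ⟨fun g => -χ (.ofMul (kerPart hs g)), ?_⟩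
    intro g h
    change χ (.ofMul (factorSet hs (π g) (π h))) = _
    beta_reduce
    rw [kerPart_mul hcent, ofMul_mul, ofMul_mul, map_add χ, map_add χ]
    abel
  · intro hx
    obtain ⟨f, rfl⟩ := H2mk_surjective x
    obtain ⟨φ, hφ⟩ := (H2mk_eq_zero_iff (pullCocycle π f)).mp hx
    replace hφ : ∀ g h, f.1 (π g) (π h) = φ g + φ h - φ (g * h) := hφ
    have hφmul : ∀ n w, π n = 1 → φ (n * w) = φ n + φ w - f.1 1 1 := fun n w hn => by
      have := hφ n w
      rw [hn, cocycle_apply_one_left] at this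
      rw [this]; abel
    let χ : Additive π.ker →+ D := AddMonoidHom.mk' (fun z => f.1 1 1 - φ z.toMul) fun z w => by
      rw [toMul_add, Subgroup.coe_mul, hφmul _ _ z.toMul.2]
      abel
    refine ⟨χ, ?_⟩
    rw [← sub_eq_zero]
    refine (H2mk_eq_zero_iff (_ - f)).mpr ⟨fun q => -φ (s q), fun q r => ?_⟩
    change f.1 1 1 - φ (factorSet hs q r) - f.1 q r = _
    have h1 := hφ (s q) (s r)
    rw [hs, hs, ← factorSet_mul hs, hφmul _ _ (factorSet hs q r).2] at h1
    beta_reduce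
    rw [h1]
    abel

theorem nonempty_ker_H2Map_equiv (D : Type) [AddCommGroup D] (hπ : Function.Surjective π)
    (hcent : ∀ z g, π z = 1 → Commute z g) (hcomm : π.ker ≤ commutator G) :
    Nonempty ((H2Map π : H2 Q D →+ H2 G D).ker ≃+ (Additive π.ker →+ D)) := by
  obtain ⟨s, hs⟩ := hπ.hasRightInverse
  exact ⟨((AddMonoidHom.ofInjective (transgression_injective hcent hs hcomm)).trans
    (AddEquiv.addSubgroupCongr (range_transgression hcent hs))).symm⟩

end Inflation

/-- The commutator pairing of a class in `H²(G, D)` between two commuting subgroups. -/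
theorem exists_commPairing {G : Type} [Group G] (H K : Subgroup G)
    (hcomm : ∀ h ∈ H, ∀ k ∈ K, Commute h k) (D : Type) [AddCommGroup D] :
    ∃ Λ : H2 G D →+ (AbTensor ↥H ↥K →+ D), ∀ (f : cocycles2 G D) (h : H) (k : K),
      Λ (H2mk f) (tmulAb h k) = f.1 h k - f.1 k h := by
  let inner (f : cocycles2 G D) (h : H) : Additive (Abelianization K) →+ D :=
    MonoidHom.toAdditiveLeft (Abelianization.lift (MonoidHom.mk'
      (fun k : K => Multiplicative.ofAdd (f.1 h k - f.1 k h)) fun k k' => by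
        rw [← ofAdd_add, Subgroup.coe_mul,
          commPairing_mul_right f (hcomm h h.2 k k.2) (hcomm h h.2 k' k'.2)]))
  have hinner : ∀ f h (k : K), inner f h (.ofMul (Abelianization.of k)) = f.1 h k - f.1 k h :=
    fun _ _ _ => rfl
  have hext : ∀ u v : Additive (Abelianization K) →+ D,
      (∀ k : K, u (.ofMul (Abelianization.of k)) = v (.ofMul (Abelianization.of k))) → u = v :=
    fun u v h => AddMonoidHom.ext fun a => by
      obtain ⟨k, hk⟩ : ∃ k, Abelianization.of k = a.toMul := QuotientGroup.mk'_surjective _ _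
      have := h k
      rw [hk] at this
      exact this
  let outer (f : cocycles2 G D) :
      Additive (Abelianization H) →+ Additive (Abelianization K) →+ D :=
    MonoidHom.toAdditiveLeft (Abelianization.lift (MonoidHom.mk'
      (fun h : H => Multiplicative.ofAdd (inner f h)) fun h h' => by
        rw [← ofAdd_add]
        congr 1
        refine hext _ _ fun k => ?_
        rw [AddMonoidHom.add_apply, hinner, hinner, hinner, Subgroup.coe_mul,
          commPairing_mul_left f (hcomm h h.2 k k.2) (hcomm h' h'.2 k k.2)]))
  let lam (f : cocycles2 G D) : AbTensor H K →+ D :=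
    TensorProduct.liftAddHom (outer f) fun n a b => by
      rw [map_zsmul, map_zsmul, AddMonoidHom.zsmul_apply]
  have hlam : ∀ f (h : H) (k : K), lam f (tmulAb h k) = f.1 h k - f.1 k h := fun _ _ _ => rfl
  have hext' : ∀ u v : AbTensor H K →+ D,
      (∀ (h : H) (k : K), u (tmulAb h k) = v (tmulAb h k)) → u = v := fun u v huv => by
    refine AddMonoidHom.ext fun w => w.induction_on (by simp) (fun a b => ?_)
      fun x y hx hy => by rw [map_add, map_add, hx, hy]
    obtain ⟨h, hh⟩ : ∃ h, Abelianization.of h = a.toMul := QuotientGroup.mk'_surjective _ _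
    obtain ⟨k, hk⟩ : ∃ k, Abelianization.of k = b.toMul := QuotientGroup.mk'_surjective _ _
    have := huv h k
    rw [tmulAb, hh, hk] at this
    exact this
  let lamHom : cocycles2 G D →+ (AbTensor H K →+ D) := AddMonoidHom.mk' lam fun f g => by
    refine hext' _ _ fun h k => ?_
    rw [AddMonoidHom.add_apply, hlam, hlam, hlam]
    change (f.1 h k + g.1 h k) - (f.1 k h + g.1 k h) = _
    abel
  refine ⟨QuotientAddGroup.lift _ lamHom fun f hf => ?_, fun f h k => hlam f h k⟩
  obtain ⟨φ, hφ⟩ := hf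
  refine hext' _ _ fun h k => ?_
  change lam f (tmulAb h k) = 0
  rw [hlam]
  change (cocycles2 G D).subtype f h k - (cocycles2 G D).subtype f k h = 0
  rw [hφ, hφ, (hcomm h h.2 k k.2).eq]
  abel

/-- A class on `Q` which restricts trivially along two commuting homomorphisms that jointly
generate `Q`, and whose commutator pairing between them vanishes, is trivial provided the
derived subgroups of the two sources meet trivially in `Q`. -/
theorem H2mk_eq_zero_of_pullCocycle {X Y Q D : Type} [Group X] [Group Y] [Group Q]
    [AddCommGroup D] [DivisibleBy D ℤ] (a : X →* Q) (b : Y →* Q)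
    (hab : ∀ x y, Commute (a x) (b y)) (hsurj : ∀ q, ∃ x y, a x * b y = q)
    (hker : ∀ x y, x ∈ commutator X → y ∈ commutator Y → a x * b y = 1 → x = 1 ∧ y = 1)
    (f : cocycles2 Q D) (ha : H2mk (pullCocycle a f) = 0) (hb : H2mk (pullCocycle b f) = 0)
    (hf : ∀ x y, f.1 (a x) (b y) = f.1 (b y) (a x)) : H2mk f = 0 := by
  let p : X × Y →* Q := a.noncommCoprod b hab
  have hp : Function.Surjective p := fun q => by
    obtain ⟨x, y, h⟩ := hsurj q
    exact ⟨(x, y), h⟩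
  refine (injective_iff_map_eq_zero _).mp
    (H2Map_injective_of_ker_inf_commutator (D := D) p hp ?_) _ ?_
  · rintro ⟨x, y⟩ h1 h2
    have hx : x ∈ commutator X := by
      have := Subgroup.mem_map_of_mem (MonoidHom.fst X Y) h2
      rw [commutator_def, Subgroup.map_commutator] at this
      exact Subgroup.commutator_mono le_top le_top this
    have hy : y ∈ commutator Y := by
      have := Subgroup.mem_map_of_mem (MonoidHom.snd X Y) h2
      rw [commutator_def, Subgroup.map_commutator] at this
      exact Subgroup.commutator_mono le_top le_top this
    obtain ⟨rfl, rfl⟩ := hker x y hx hy h1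
    rfl
  · obtain ⟨φ, hφ⟩ := (H2mk_eq_zero_iff _).mp ha
    obtain ⟨ψ, hψ⟩ := (H2mk_eq_zero_iff _).mp hb
    replace hφ : ∀ x x', f.1 (a x) (a x') = φ x + φ x' - φ (x * x') := hφ
    replace hψ : ∀ y y', f.1 (b y) (b y') = ψ y + ψ y' - ψ (y * y') := hψ
    refine (H2mk_eq_zero_iff (pullCocycle p f)).mpr
      ⟨fun w => φ w.1 + ψ w.2 - f.1 (a w.1) (b w.2), ?_⟩
    rintro ⟨x, y⟩ ⟨x', y'⟩
    change f.1 (a x * b y) (a x' * b y') = _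
    rw [cocycle_mul_mul f (hab x' y).symm (hf x' y).symm, hφ, hψ, ← map_mul, ← map_mul]
    simp only [Prod.mk_mul_mk]
    abel

/-- If `r` and `t` jointly detect classes through a surjection `π`, then `B` embeds into
`(C ⧸ N) × T`, where `N` is the isomorphic image of `ker π` under `r`. -/
theorem exists_embedding_quotient_prod {A B C T : Type} [AddCommGroup A] [AddCommGroup B]
    [AddCommGroup C] [AddCommGroup T] (π : A →+ B) (hπ : Function.Surjective π) (r : A →+ C)
    (t : B →+ T) (hinj : ∀ x, r x = 0 → t (π x) = 0 → x = 0) :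
    ∃ N : AddSubgroup C, Nonempty (N ≃+ π.ker) ∧
      ∃ ι : B →+ (C ⧸ N) × T, Function.Injective ι := by
  have hr : Function.Injective (r.comp π.ker.subtype) := by
    rw [injective_iff_map_eq_zero]
    rintro ⟨x, hx⟩ hrx
    exact Subtype.ext (hinj x hrx (by rw [AddMonoidHom.mem_ker.mp hx, map_zero]))
  refine ⟨(r.comp π.ker.subtype).range, ⟨(AddMonoidHom.ofInjective hr).symm⟩, ?_⟩
  let g := (QuotientAddGroup.mk' (r.comp π.ker.subtype).range).comp r
  have hg : π.ker ≤ g.ker := fun x hx =>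
    (QuotientAddGroup.eq_zero_iff (r x)).mpr ⟨⟨x, hx⟩, rfl⟩
  let u := π.liftOfSurjective hπ ⟨g, hg⟩
  have hu : ∀ x, u (π x) = g x := π.liftOfRightInverse_comp_apply _ _ ⟨g, hg⟩
  refine ⟨u.prod t, (injective_iff_map_eq_zero _).mpr fun y hy => ?_⟩
  obtain ⟨x, rfl⟩ := hπ y
  have h1 : g x = 0 := (hu x).symm.trans (congrArg Prod.fst hy)
  have h2 : t (π x) = 0 := congrArg Prod.snd hy
  obtain ⟨⟨z, hz⟩, hzx⟩ := (QuotientAddGroup.eq_zero_iff (r x)).mp h1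
  have hz' : π z = 0 := hz
  replace hzx : r z = r x := hzx
  have := hinj (x - z) (by rw [map_sub, hzx, sub_self]) (by rw [map_sub, hz', sub_zero, h2])
  rw [sub_eq_zero.mp this, hz']

theorem exists_mem_of_mem_commutator_quotient {G : Type} [Group G] {H : Subgroup G}
    {M : Subgroup H} [M.Normal] {x : H ⧸ M} (hx : x ∈ commutator (H ⧸ M)) :
    ∃ h : H, (h : G) ∈ ⁅H, H⁆ ∧ QuotientGroup.mk h = x := by
  rw [commutator_def, ← Subgroup.map_top_of_surjective _ (QuotientGroup.mk'_surjective M),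
    ← Subgroup.map_commutator] at hx
  obtain ⟨h, hh, rfl⟩ := hx
  exact ⟨h, H.map_subtype_commutator ▸ Subgroup.mem_map_of_mem H.subtype hh, rfl⟩

/-- **Theorem B (ii).** There is a subgroup `N ≅ Hom(Z, D)` of
`H²(H/Z, D) ⊕ H²(K/Z, D)` such that `H²(G, D)` embeds into
`((H²(H/Z, D) ⊕ H²(K/Z, D))/N) ⊕ Hom(H ⊗ K, D)`. -/
theorem theoremB_ii {G : Type} [Group G] (H K : Subgroup G) [H.Normal] [K.Normal]
    (hprod : H ⊔ K = ⊤) (hcomm : ∀ h ∈ H, ∀ k ∈ K, Commute h k)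
    (D : Type) [AddCommGroup D] [DivisibleBy D ℤ]
    [((⁅H, H⁆ ⊓ ⁅K, K⁆).subgroupOf H).Normal] [((⁅H, H⁆ ⊓ ⁅K, K⁆).subgroupOf K).Normal] :
    ∃ N : AddSubgroup
        (H2 (↥H ⧸ (⁅H, H⁆ ⊓ ⁅K, K⁆).subgroupOf H) D ×
         H2 (↥K ⧸ (⁅H, H⁆ ⊓ ⁅K, K⁆).subgroupOf K) D),
      Nonempty (↥N ≃+ (Additive ↥(⁅H, H⁆ ⊓ ⁅K, K⁆) →+ D)) ∧
      ∃ ι : H2 G D →+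
          (((H2 (↥H ⧸ (⁅H, H⁆ ⊓ ⁅K, K⁆).subgroupOf H) D ×
             H2 (↥K ⧸ (⁅H, H⁆ ⊓ ⁅K, K⁆).subgroupOf K) D) ⧸ N) ×
           (AbTensor ↥H ↥K →+ D)),
        Function.Injective ι := by
  set Z := ⁅H, H⁆ ⊓ ⁅K, K⁆
  have hsurj : ∀ g : G, ∃ h : H, ∃ k : K, (h : G) * k = g := fun g => by
    have hg : g ∈ H ⊔ K := hprod ▸ Subgroup.mem_top g
    obtain ⟨h, hh, k, hk, rfl⟩ := Subgroup.mem_sup_of_normal_left.mp hg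
    exact ⟨⟨h, hh⟩, ⟨k, hk⟩, rfl⟩
  have hZH : Z ≤ H := inf_le_left.trans (commutator_le_self H)
  have hZK : Z ≤ K := inf_le_right.trans (commutator_le_self K)
  have hZcent : ∀ z ∈ Z, ∀ g, Commute z g := fun z hz g => by
    obtain ⟨h, k, rfl⟩ := hsurj g
    exact (hcomm h h.2 z (hZK hz)).symm.mul_right (hcomm z (hZH hz) k k.2)
  have hker : ∀ z, QuotientGroup.mk' Z z = 1 ↔ z ∈ Z := QuotientGroup.eq_one_iff
  have hinfl : Function.Surjective
      (H2Map (QuotientGroup.mk' Z) : H2 (G ⧸ Z) D →+ H2 G D) := by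
    refine H2Map_surjective_of_commPairing (QuotientGroup.mk'_surjective Z)
      (fun z g hz => hZcent z ((hker z).mp hz) g) fun f z g hz => ?_
    rw [hker] at hz
    obtain ⟨h, k, rfl⟩ := hsurj g
    have h1 := cocycle_comm_of_mem_commutator f (fun x hx => hcomm x hx k k.2) hz.1
    have h2 := cocycle_comm_of_mem_commutator f (fun x hx => (hcomm h h.2 x hx).symm) hz.2
    have h3 := commPairing_mul_right f (hZcent z hz h) (hZcent z hz k)
    rwa [h1, h2, sub_self, sub_self, add_zero, sub_eq_zero] at h3
  obtain ⟨Λ, hΛ⟩ := exists_commPairing H K hcomm D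
  have hinj : ∀ x : H2 (G ⧸ Z) D,
      ((H2Map (quotInclusion H Z)).prod (H2Map (quotInclusion K Z))) x = 0 →
      Λ (H2Map (QuotientGroup.mk' Z) x) = 0 → x = 0 := by
    intro x hx hΛx
    obtain ⟨f, rfl⟩ := H2mk_surjective x
    refine H2mk_eq_zero_of_pullCocycle (quotInclusion H Z) (quotInclusion K Z) ?_ ?_ ?_ f
      (congrArg Prod.fst hx) (congrArg Prod.snd hx) ?_
    · rintro ⟨h⟩ ⟨k⟩
      exact congrArg (QuotientGroup.mk' Z) (hcomm h h.2 k k.2)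
    · rintro ⟨g⟩
      obtain ⟨h, k, rfl⟩ := hsurj g
      exact ⟨QuotientGroup.mk h, QuotientGroup.mk k, rfl⟩
    · intro x y hx hy hxy
      obtain ⟨h, hh, rfl⟩ := exists_mem_of_mem_commutator_quotient hx
      obtain ⟨k, hk, rfl⟩ := exists_mem_of_mem_commutator_quotient hy
      have hhk : (h : G) * k ∈ Z := (hker _).mp hxy
      have hhZ : (h : G) ∈ Z := ⟨hh, (Subgroup.mul_mem_cancel_right _ hk).mp hhk.2⟩
      have hkZ : (k : G) ∈ Z := ⟨(Subgroup.mul_mem_cancel_left _ hh).mp hhk.1, hk⟩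
      exact ⟨(QuotientGroup.eq_one_iff h).mpr hhZ, (QuotientGroup.eq_one_iff k).mpr hkZ⟩
    · rintro ⟨h⟩ ⟨k⟩
      have := hΛ (pullCocycle (QuotientGroup.mk' Z) f) h k
      rw [show H2mk (pullCocycle (QuotientGroup.mk' Z) f) = H2Map (QuotientGroup.mk' Z) (H2mk f)
        from rfl, hΛx] at this
      exact sub_eq_zero.mp this.symm
  obtain ⟨N, ⟨e⟩, ι⟩ := exists_embedding_quotient_prod
    (H2Map (QuotientGroup.mk' Z) : H2 (G ⧸ Z) D →+ H2 G D) hinfl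
    ((H2Map (quotInclusion H Z)).prod (H2Map (quotInclusion K Z))) Λ hinj
  obtain ⟨e'⟩ := nonempty_ker_H2Map_equiv D (QuotientGroup.mk'_surjective Z)
    (fun z g hz => hZcent z ((hker z).mp hz) g) (by
      rw [QuotientGroup.ker_mk']
      exact inf_le_left.trans (Subgroup.commutator_mono le_top le_top))
  let c : Additive (QuotientGroup.mk' Z).ker ≃+ Additive Z :=
    MulEquiv.toAdditive (MulEquiv.subgroupCongr (QuotientGroup.ker_mk' Z))
  exact ⟨N, ⟨(e.trans e').trans c.addMonoidHomCongrLeft⟩, ι⟩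

end SchurCP
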